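/- For every integer n >= 3, M(2,n) = ceil(3n/2) - 3. -/

import Mathlib

/-- The simple transposition `s_i = (i, i+1)` (1-indexed values) in `S_n`,
realized on `Fin n` (0-indexed positions `i-1` and `i`); junk value `1` otherwise. -/
def sgen (n i : ℕ) : Equiv.Perm (Fin n) :=
  if h : 0 < i ∧ i < n then Equiv.swap ⟨i - 1, by omega⟩ ⟨i, h.2⟩ else 1

/-- `l` is a reduced word for `w ∈ S_n`: its product is `w` and it has minimal length. -/
def IsReducedWordFor (n : ℕ) (l : List ℕ) (w : Equiv.Perm (Fin n)) : Prop :=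
  (l.map (sgen n)).prod = w ∧
    ∀ l' : List ℕ, (l'.map (sgen n)).prod = w → l.length ≤ l'.length

/-- The longest permutation `w_0 = n (n-1) ⋯ 2 1` of `S_n`. -/
def longestPerm (n : ℕ) : Equiv.Perm (Fin n) := Fin.revPerm

/-- `M(k,n)`: the maximum multiplicity of `s_k` among reduced words of `w_0 ∈ S_n`. -/
noncomputable def Mmax (k n : ℕ) : ℕ :=
  sSup {N | ∃ l : List ℕ, IsReducedWordFor n l (longestPerm n) ∧ l.count k = N}

/-- Two finite sets are weakly separated. -/
def WeaklySeparated (I J : Finset ℕ) : Prop :=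
  (∀ a ∈ I \ J, ∀ b ∈ J \ I, a < b) ∨ (∀ b ∈ J \ I, ∀ a ∈ I \ J, b < a)

/-- A monotone weakly separated path: pairwise weakly separated, and each step removes
one element `y` and adds one element `x > y`. -/
def IsMWSPath (P : List (Finset ℕ)) : Prop :=
  (∀ A ∈ P, ∀ B ∈ P, WeaklySeparated A B) ∧
    List.Chain' (fun A B => ∃ x y, y ∈ A ∧ x ∉ A ∧ y < x ∧ B = insert x (A.erase y)) P

/-- Two arcs on a linear order are compatible if they share an endpoint or one lies entirely
to the left of the other. -/
def ArcCompatible {α : Type*} [LT α] (p q : α × α) : Prop :=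
  p.1 = q.1 ∨ p.1 = q.2 ∨ p.2 = q.1 ∨ p.2 = q.2 ∨ p.2 < q.1 ∨ q.2 < p.1

theorem ArcCompatible.symm {α : Type*} [LT α] {p q : α × α} (h : ArcCompatible p q) :
    ArcCompatible q p := by
  obtain h | h | h | h | h | h := h <;> simp [ArcCompatible, h]

/-- A family of pairwise compatible arcs on `n` points has at most `3 (n - 1) / 2` members. -/
theorem two_mul_card_le_of_arcCompatible (n : ℕ) (E : Finset (ℕ × ℕ))
    (hlt : ∀ p ∈ E, p.1 < p.2) (hn : ∀ p ∈ E, p.2 < n)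
    (hE : ∀ p ∈ E, ∀ q ∈ E, ArcCompatible p q) : 2 * E.card ≤ 3 * (n - 1) := by
  induction n using Nat.strong_induction_on generalizing E with
  | _ n ih =>
  rcases n with _ | m
  · have : E = ∅ := Finset.eq_empty_of_forall_notMem fun p hp => by simpa using hn p hp
    simp [this]
  by_cases hm : ∃ z, (z, m) ∈ E
  swap
  · have := ih m (by omega) E hlt (fun p hp => by
      have h1 := hn p hp
      have h2 : p.2 ≠ m := fun h => hm ⟨p.1, by rw [← h]; exact hp⟩
      omega) hE
    omega
  classical
  obtain ⟨a, ha, hmin⟩ : ∃ a, (a, m) ∈ E ∧ ∀ z, (z, m) ∈ E → a ≤ z :=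
    ⟨Nat.find hm, Nat.find_spec hm, fun z hz => Nat.find_min' hm hz⟩
  have ham : a < m := hlt _ ha
  have hleft := ih (a + 1) (by omega) (E.filter fun p => p.2 ≤ a)
    (fun p hp => hlt p (Finset.mem_filter.1 hp).1)
    (fun p hp => Nat.lt_succ_of_le (Finset.mem_filter.1 hp).2)
    (fun p hp q hq => hE p (Finset.mem_filter.1 hp).1 q (Finset.mem_filter.1 hq).1)
  have hsplit := Finset.card_filter_add_card_filter_not (s := E) (fun p => p.2 ≤ a)
  have hshape : ∀ p ∈ E.filter (fun p => ¬ p.2 ≤ a),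
      p ∈ E ∧ a < p.2 ∧ p.2 ≤ m ∧ p.1 < p.2 ∧ (p.1 = a ∨ (a < p.1 ∧ p.2 = m)) := by
    rintro ⟨x, y⟩ hp
    obtain ⟨hp, hya⟩ := Finset.mem_filter.1 hp
    have h1 := hlt _ hp
    have h2 := hn _ hp
    have h3 := hE _ hp _ ha
    have h4 : y = m → a ≤ x := fun h => hmin x (h ▸ hp)
    simp only [ArcCompatible] at *
    exact ⟨hp, by omega, by omega, h1, by omega⟩
  have hright : 2 * (E.filter fun p => ¬ p.2 ≤ a).card ≤ 3 * (m - a) := by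
    rcases Nat.lt_or_ge (a + 1) m with h | h
    · have hcard : (E.filter fun p => ¬ p.2 ≤ a).card ≤ (Finset.Icc a m).card := by
        apply Finset.card_le_card_of_injOn
          (fun p => if p.1 = a then (if p.2 = m then a else p.2) else p.1 + 1)
        · intro p hp
          have := hshape p hp
          simp only [Finset.coe_Icc, Set.mem_Icc]
          split_ifs <;> omega
        · rintro ⟨x, y⟩ hp ⟨x', y'⟩ hq hpq
          obtain ⟨hp, h1⟩ := hshape _ hp
          obtain ⟨hq, h2⟩ := hshape _ hq
          have h3 := hE _ hp _ hq
          simp only [ArcCompatible, Prod.mk.injEq] at *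
          split_ifs at hpq <;> omega
      rw [Nat.card_Icc] at hcard
      omega
    · have hcard : (E.filter fun p => ¬ p.2 ≤ a).card ≤ ({(a, m)} : Finset (ℕ × ℕ)).card := by
        apply Finset.card_le_card
        rintro ⟨x, y⟩ hp
        have := hshape _ hp
        simp only [Finset.mem_singleton, Prod.mk.injEq] at *
        omega
      rw [Finset.card_singleton] at hcard
      omega
  omega

/-- The inversions of `w`, recorded as pairs of values `x < y` with `y` placed before `x`. -/
def valueInversions {n : ℕ} (w : Equiv.Perm (Fin n)) : Finset (Fin n × Fin n) :=
  Finset.univ.filter fun p => p.1 < p.2 ∧ w⁻¹ p.2 < w⁻¹ p.1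

theorem mem_valueInversions {n : ℕ} {w : Equiv.Perm (Fin n)} {p : Fin n × Fin n} :
    p ∈ valueInversions w ↔ p.1 < p.2 ∧ w⁻¹ p.2 < w⁻¹ p.1 := by
  simp [valueInversions]

theorem valueInversions_one (n : ℕ) : valueInversions (1 : Equiv.Perm (Fin n)) = ∅ := by
  ext p
  simp only [mem_valueInversions, inv_one, Equiv.Perm.one_apply, Finset.notMem_empty, iff_false]
  exact fun h => lt_asymm h.1 h.2

theorem two_mul_card_valueInversions_longestPerm (n : ℕ) :
    2 * (valueInversions (longestPerm n)).card = n * (n - 1) := by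
  have h : valueInversions (longestPerm n)
      = Finset.univ.biUnion fun y : Fin n => (Finset.Iio y).image fun x => (x, y) := by
    ext ⟨x, y⟩
    have : (longestPerm n)⁻¹ = longestPerm n := by
      ext z; simp [longestPerm, Equiv.Perm.inv_def]
    rw [mem_valueInversions, this]
    simp [longestPerm]
  rw [h, Finset.card_biUnion]
  · have h2 : ∀ y : Fin n, ((Finset.Iio y).image fun x => (x, y)).card = (y : ℕ) := fun y => by
      rw [Finset.card_image_of_injective _ (fun _ _ h => (Prod.mk.inj h).1), Fin.card_Iio]
    simp only [h2]
    rw [Fin.sum_univ_eq_sum_range (fun i => i), mul_comm, Finset.sum_range_id_mul_two]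
  · intro y _ y' _ hne
    rw [Function.onFun, Finset.disjoint_left]
    rintro ⟨a, b⟩ h1 h2
    simp only [Finset.mem_image, Prod.mk.injEq] at h1 h2
    obtain ⟨_, _, _, rfl⟩ := h1
    obtain ⟨_, _, _, rfl⟩ := h2
    exact hne rfl

theorem sgen_of_lt {n i : ℕ} (h : 0 < i ∧ i < n) :
    sgen n i = Equiv.swap ⟨i - 1, by omega⟩ ⟨i, h.2⟩ := dif_pos h

theorem valueInversions_mul_sgen_subset {n i : ℕ} (h : 0 < i ∧ i < n) (w : Equiv.Perm (Fin n)) :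
    valueInversions (w * sgen n i) ⊆
      insert (w ⟨i - 1, by omega⟩, w ⟨i, h.2⟩) (valueInversions w) := by
  rintro ⟨x, y⟩ hp
  rw [mem_valueInversions] at hp
  obtain ⟨hxy, hp⟩ := hp
  rw [Finset.mem_insert, mem_valueInversions]
  obtain ⟨u, rfl⟩ := w.surjective x
  obtain ⟨v, rfl⟩ := w.surjective y
  have huv : u ≠ v := by rintro rfl; exact lt_irrefl _ hxy
  simp only [sgen_of_lt h, mul_inv_rev, Equiv.swap_inv, Equiv.Perm.mul_apply,
    Equiv.Perm.coe_inv, Equiv.symm_apply_apply, Equiv.swap_apply_def, Fin.ext_iff] at hp ⊢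
  by_cases hvu : v < u
  · exact Or.inr ⟨hxy, hvu⟩
  · left
    have hu : u.val = i - 1 ∧ v.val = i := by
      simp only [Fin.lt_def] at hvu
      split_ifs at hp <;> simp only [Fin.lt_def] at hp <;> omega
    obtain ⟨u, _⟩ := u
    obtain ⟨v, _⟩ := v
    obtain ⟨rfl, rfl⟩ := hu
    rfl

theorem card_valueInversions_mul_sgen_le {n : ℕ} (i : ℕ) (w : Equiv.Perm (Fin n)) :
    (valueInversions (w * sgen n i)).card ≤ (valueInversions w).card + 1 := by
  by_cases h : 0 < i ∧ i < n
  · exact (Finset.card_le_card (valueInversions_mul_sgen_subset h w)).trans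
      (Finset.card_insert_le _ _)
  · simp [sgen, h]

theorem card_valueInversions_prod_le {n : ℕ} (l : List ℕ) :
    (valueInversions (l.map (sgen n)).prod).card ≤ l.length := by
  induction l using List.reverseRecOn with
  | nil => simp [valueInversions_one]
  | append_singleton l i ih =>
    have := card_valueInversions_mul_sgen_le i (l.map (sgen n)).prod
    simp only [List.map_append, List.map_cons, List.map_nil, List.prod_append, List.prod_cons,
      List.prod_nil, mul_one, List.length_append, List.length_cons, List.length_nil]
    omega

/-- A right multiplication by a generator that creates an inversion keeps the old ones and
swaps two adjacent entries that were in increasing order. -/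
theorem valueInversions_subset_mul_sgen {n i : ℕ} {w : Equiv.Perm (Fin n)}
    (hc : (valueInversions (w * sgen n i)).card = (valueInversions w).card + 1) :
    valueInversions w ⊆ valueInversions (w * sgen n i) ∧
      ∃ h : 0 < i ∧ i < n, w ⟨i - 1, by omega⟩ < w ⟨i, h.2⟩ := by
  by_cases h : 0 < i ∧ i < n
  · have heq := Finset.eq_of_subset_of_card_le (valueInversions_mul_sgen_subset h w)
      (hc ▸ Finset.card_insert_le _ _)
    rw [heq]
    refine ⟨Finset.subset_insert _ _, h, ?_⟩
    have hmem : (w ⟨i - 1, by omega⟩, w ⟨i, h.2⟩) ∈ valueInversions (w * sgen n i) := by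
      rw [heq]; exact Finset.mem_insert_self _ _
    exact (mem_valueInversions.1 hmem).1
  · simp [sgen, h] at hc

/-- The sets formed by the first two entries along a word whose length equals the number of
inversions of its product form a family of pairwise compatible arcs, with one new arc for
each occurrence of `2`. -/
theorem exists_arcs_of_card_valueInversions_eq {n : ℕ} (hn : 2 ≤ n) (l : List ℕ)
    (hl : (valueInversions (l.map (sgen n)).prod).card = l.length) :
    ∃ E : Finset (Fin n × Fin n), E.card = l.count 2 + 1 ∧ (∀ p ∈ E, p.1 < p.2) ∧
      (∀ p ∈ E, ∀ q ∈ E, ArcCompatible p q) ∧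
      (∀ p ∈ E, ∀ c e, (c = p.1 ∨ c = p.2) → e ≠ p.1 → e ≠ p.2 → e < c →
        (e, c) ∈ valueInversions (l.map (sgen n)).prod) ∧
      (∀ p ∈ E, p.1.val + p.2.val ≤
        ((l.map (sgen n)).prod ⟨0, by omega⟩).val + ((l.map (sgen n)).prod ⟨1, by omega⟩).val) := by
  induction l using List.reverseRecOn with
  | nil =>
    refine ⟨{(⟨0, by omega⟩, ⟨1, by omega⟩)}, by simp, ?_, ?_, ?_, by simp⟩
    · simp only [Finset.mem_singleton, forall_eq]
      exact Nat.zero_lt_one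
    · simp [ArcCompatible]
    · simp only [Finset.mem_singleton, forall_eq]
      rintro c e hc h0 h1 hec
      simp only [Fin.ext_iff, Fin.lt_def, ne_eq] at *
      omega
  | append_singleton l i ih =>
    simp only [List.map_append, List.map_cons, List.map_nil, List.prod_append, List.prod_cons,
      List.prod_nil, mul_one, List.length_append, List.length_cons, List.length_nil,
      List.count_append, zero_add] at hl ⊢
    have hle := card_valueInversions_prod_le (n := n) l
    have hstep := card_valueInversions_mul_sgen_le i (l.map (sgen n)).prod
    obtain ⟨E, hcard, hlt, hcompat, hinv, hsum⟩ := ih (by omega)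
    generalize (l.map (sgen n)).prod = w at *
    obtain ⟨hsub, hi, hasc⟩ := valueInversions_subset_mul_sgen (w := w) (i := i) (by omega)
    have hinv' : ∀ p ∈ E, ∀ c e, (c = p.1 ∨ c = p.2) → e ≠ p.1 → e ≠ p.2 → e < c →
        (e, c) ∈ valueInversions (w * sgen n i) :=
      fun p hp c e hc h1 h2 h => hsub (hinv p hp c e hc h1 h2 h)
    by_cases h2 : i = 2
    swap
    · refine ⟨E, by simp [h2, hcard], hlt, hcompat, hinv', fun p hp => ?_⟩
      refine (hsum p hp).trans_eq ?_
      rw [sgen_of_lt hi]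
      simp only [Equiv.Perm.mul_apply]
      by_cases h1 : i = 1
      · subst h1
        simp only [Nat.sub_self, Equiv.swap_apply_left, Equiv.swap_apply_right]
        exact add_comm _ _
      · rw [Equiv.swap_apply_of_ne_of_ne, Equiv.swap_apply_of_ne_of_ne] <;>
          simp [Fin.ext_iff] <;> omega
    subst h2
    have hw0 : (w * sgen n 2) ⟨0, by omega⟩ = w ⟨0, by omega⟩ := by
      rw [sgen_of_lt hi, Equiv.Perm.mul_apply, Equiv.swap_apply_of_ne_of_ne] <;>
        simp [Fin.ext_iff]
    have hw1 : (w * sgen n 2) ⟨1, by omega⟩ = w ⟨2, hi.2⟩ := by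
      rw [sgen_of_lt hi, Equiv.Perm.mul_apply]
      simp
    have hgrow : (w ⟨0, by omega⟩).val + (w ⟨1, by omega⟩).val <
        ((w * sgen n 2) ⟨0, by omega⟩).val + ((w * sgen n 2) ⟨1, by omega⟩).val := by
      rw [hw0, hw1]
      exact Nat.add_lt_add_left hasc _
    generalize w * sgen n 2 = v at *
    obtain ⟨x, y, hxy, hv⟩ : ∃ x y, x < y ∧
        ((x = v ⟨0, by omega⟩ ∧ y = v ⟨1, by omega⟩) ∨
          (x = v ⟨1, by omega⟩ ∧ y = v ⟨0, by omega⟩)) := by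
      rcases lt_trichotomy (v ⟨0, by omega⟩) (v ⟨1, by omega⟩) with h | h | h
      · exact ⟨_, _, h, Or.inl ⟨rfl, rfl⟩⟩
      · simp at h
      · exact ⟨_, _, h, Or.inr ⟨rfl, rfl⟩⟩
    have hxysum : x.val + y.val = (v ⟨0, by omega⟩).val + (v ⟨1, by omega⟩).val := by
      rcases hv with ⟨rfl, rfl⟩ | ⟨rfl, rfl⟩
      · rfl
      · exact add_comm _ _
    have hfirst : ∀ c e, (c = x ∨ c = y) → e ≠ x → e ≠ y → v⁻¹ c < v⁻¹ e := by
      intro c e hc hex hey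
      obtain ⟨e, rfl⟩ := v.surjective e
      obtain ⟨c, rfl⟩ := v.surjective c
      rw [Equiv.Perm.coe_inv, Equiv.symm_apply_apply, Equiv.symm_apply_apply]
      rcases hv with ⟨rfl, rfl⟩ | ⟨rfl, rfl⟩ <;>
      · rw [EmbeddingLike.apply_eq_iff_eq, EmbeddingLike.apply_eq_iff_eq] at hc
        rw [ne_eq, EmbeddingLike.apply_eq_iff_eq] at hex hey
        simp only [Fin.ext_iff, Fin.lt_def] at hc hex hey ⊢
        omega
    have hnew : ∀ p ∈ E, ArcCompatible p (x, y) := by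
      intro p hp
      by_contra hcon
      simp only [ArcCompatible, not_or, not_lt] at hcon
      obtain ⟨h1, h2, h3, h4, h5, -⟩ := hcon
      have hmem := hinv' p hp p.2 x (Or.inr rfl) (Ne.symm h1) (Ne.symm h3)
        (lt_of_le_of_ne h5 (Ne.symm h3))
      exact lt_asymm (mem_valueInversions.1 hmem).2 (hfirst x p.2 (Or.inl rfl) h3 h4)
    have hnotMem : (x, y) ∉ E := fun h => by
      have := hsum _ h
      simp only at this
      omega
    refine ⟨insert (x, y) E, ?_, ?_, ?_, ?_, ?_⟩
    · rw [Finset.card_insert_of_notMem hnotMem, hcard]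
      simp
    · simpa [hxy] using fun a b h => hlt (a, b) h
    · intro p hp q hq
      rcases Finset.mem_insert.1 hp with rfl | hp <;> rcases Finset.mem_insert.1 hq with rfl | hq
      · exact Or.inl rfl
      · exact (hnew _ hq).symm
      · exact hnew _ hp
      · exact hcompat _ hp _ hq
    · intro p hp c e hc h1 h2 hec
      rcases Finset.mem_insert.1 hp with rfl | hp
      · exact mem_valueInversions.2 ⟨hec, hfirst c e hc h1 h2⟩
      · exact hinv' p hp c e hc h1 h2 hec
    · intro p hp
      rcases Finset.mem_insert.1 hp with rfl | hp
      · exact hxysum.le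
      · exact (hsum p hp).trans hgrow.le

theorem two_mul_count_two_le {n : ℕ} (hn : 2 ≤ n) (l : List ℕ)
    (hl : (valueInversions (l.map (sgen n)).prod).card = l.length) :
    2 * (l.count 2 + 1) ≤ 3 * (n - 1) := by
  obtain ⟨E, hcard, hlt, hcompat, -⟩ := exists_arcs_of_card_valueInversions_eq hn l hl
  have hinj : Function.Injective (Prod.map Fin.val Fin.val : Fin n × Fin n → ℕ × ℕ) :=
    Fin.val_injective.prodMap Fin.val_injective
  rw [← hcard, ← Finset.card_image_of_injective E hinj]
  apply two_mul_card_le_of_arcCompatible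
  · simp only [Finset.forall_mem_image]
    exact fun p hp => hlt p hp
  · simp only [Finset.forall_mem_image]
    exact fun p _ => p.2.isLt
  · simp only [Finset.forall_mem_image]
    intro p hp q hq
    simpa only [ArcCompatible, Prod.map_fst, Prod.map_snd, Fin.ext_iff, Fin.lt_def]
      using hcompat p hp q hq

/-- A reduced word of the longest permutation with as many letters `2` as possible: it sends
`1, 2, …, n + 2` to `3, …, n + 2, 2, 1` and then reverses the first `n` entries. -/
def richWord : ℕ → List ℕ
  | 0 => []
  | 1 => []
  | 2 => [1]
  | n + 3 => [2, 1] ++ List.range' 2 (n + 1) ++ List.range' 2 n ++ richWord (n + 1)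

theorem two_mul_length_richWord (n : ℕ) : 2 * (richWord n).length = n * (n - 1) := by
  induction n using richWord.induct with
  | case1 | case2 | case3 => simp [richWord]
  | case4 n ih =>
    simp only [richWord, List.length_append, List.length_range', List.length_cons,
      List.length_nil, Nat.add_sub_cancel] at ih ⊢
    have : n + 3 - 1 = n + 2 := rfl
    rw [this]
    linarith

theorem count_two_richWord {n : ℕ} (hn : 2 ≤ n) : (richWord n).count 2 = (3 * n - 5) / 2 := by
  induction n using richWord.induct with
  | case1 | case2 => omega
  | case3 => simp [richWord]
  | case4 n ih =>
    rcases n with _ | n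
    · simp [richWord]
    · have := ih (by omega)
      have h : ∀ m, (List.range' 2 (m + 1)).count 2 = 1 := fun m => by
        rw [List.count_range_1']; simp
      simp only [richWord, List.count_append, h, this]
      simp
      omega

theorem mem_richWord {n i : ℕ} (hi : i ∈ richWord n) : 0 < i ∧ i < n := by
  induction n using richWord.induct with
  | case1 | case2 => simp [richWord] at hi
  | case3 => simp [richWord] at hi; omega
  | case4 n ih =>
    simp only [richWord, List.mem_append, List.mem_cons, List.not_mem_nil, or_false,
      List.mem_range'_1] at hi
    rcases hi with ((hi | hi) | hi) | hi
    · omega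
    · omega
    · omega
    · have := ih hi
      omega

theorem val_prod_sgen {n : ℕ} (l : List ℕ) (hl : ∀ i ∈ l, 0 < i ∧ i < n) (x : Fin n) :
    ((l.map (sgen n)).prod x).val =
      (l.map fun i => Equiv.swap (i - 1) i).prod x.val := by
  induction l with
  | nil => simp
  | cons i l ih =>
    have ih := ih fun j hj => hl j (List.mem_cons_of_mem _ hj)
    have hi := hl i List.mem_cons_self
    simp only [List.map_cons, List.prod_cons, Equiv.Perm.mul_apply, ← ih, sgen_of_lt hi,
      Equiv.swap_apply_def, Fin.ext_iff]
    split_ifs <;> rfl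

theorem prod_swap_range'_two_apply (m x : ℕ) :
    ((List.range' 2 m).map fun i => Equiv.swap (i - 1) i).prod x =
      if x = m + 1 then 1 else if 1 ≤ x ∧ x ≤ m then x + 1 else x := by
  induction m generalizing x with
  | zero =>
    simp only [List.range'_zero, List.map_nil, List.prod_nil, Equiv.Perm.one_apply]
    split_ifs <;> omega
  | succ m ih =>
    rw [List.range'_1_concat, List.map_append, List.prod_append, Equiv.Perm.mul_apply, ih]
    simp only [List.map_cons, List.map_nil, List.prod_cons, List.prod_nil, mul_one,
      Equiv.swap_apply_def]
    split_ifs <;> omega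

theorem prod_swap_richWord_apply {n x : ℕ} (hx : x < n) :
    ((richWord n).map fun i => Equiv.swap (i - 1) i).prod x = n - 1 - x := by
  induction n using richWord.induct generalizing x with
  | case1 => omega
  | case2 => simp [richWord]; omega
  | case3 => interval_cases x <;> simp [richWord]
  | case4 n ih =>
    have hprefix : ((richWord (n + 1)).map fun i => Equiv.swap (i - 1) i).prod x =
        if x < n + 1 then n - x else x := by
      split_ifs with h
      · exact ih h
      · have : ∀ l : List ℕ, (∀ i ∈ l, i < x) →
            (l.map fun i => Equiv.swap (i - 1) i).prod x = x := by
          intro l hl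
          induction l with
          | nil => simp
          | cons i l ihl =>
            have hi := hl i List.mem_cons_self
            rw [List.map_cons, List.prod_cons, Equiv.Perm.mul_apply,
              ihl fun j hj => hl j (List.mem_cons_of_mem _ hj),
              Equiv.swap_apply_of_ne_of_ne] <;> omega
        exact this _ fun i hi => by have := mem_richWord hi; omega
    rw [richWord]
    simp only [List.map_append, List.prod_append, Equiv.Perm.mul_apply, hprefix,
      prod_swap_range'_two_apply]
    simp only [List.map_cons, List.map_nil, List.prod_cons, List.prod_nil, mul_one,
      Equiv.Perm.mul_apply]
    generalize hy : (if x < n + 1 then n - x else x) = y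
    generalize hz : (if y = n + 1 then 1 else if 1 ≤ y ∧ y ≤ n then y + 1 else y) = z
    generalize hu : (if z = n + 1 + 1 then 1 else if 1 ≤ z ∧ z ≤ n + 1 then z + 1 else z) = u
    have hswap : Equiv.swap (2 - 1) 2 (Equiv.swap (1 - 1) 1 u) =
        if u = 0 then 2 else if u = 1 then 0 else if u = 2 then 1 else u := by
      simp only [Equiv.swap_apply_def]
      split_ifs <;> omega
    rw [hswap]
    split_ifs at hy hz hu ⊢ <;> omega

theorem prod_sgen_richWord (n : ℕ) : ((richWord n).map (sgen n)).prod = longestPerm n := by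
  ext x
  rw [val_prod_sgen _ fun i hi => mem_richWord hi, prod_swap_richWord_apply x.isLt]
  simp [longestPerm, Fin.val_rev]
  omega

theorem isReducedWordFor_longestPerm_iff {n : ℕ} {l : List ℕ} :
    IsReducedWordFor n l (longestPerm n) ↔
      (l.map (sgen n)).prod = longestPerm n ∧
        (valueInversions (longestPerm n)).card = l.length := by
  have hrich := two_mul_length_richWord n
  have hinv := two_mul_card_valueInversions_longestPerm n
  constructor
  · rintro ⟨h, hmin⟩
    have h1 := hmin _ (prod_sgen_richWord n)
    have h2 := card_valueInversions_prod_le (n := n) l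
    rw [h] at h2
    exact ⟨h, by omega⟩
  · rintro ⟨h, hlen⟩
    refine ⟨h, fun l' hl' => ?_⟩
    rw [← hlen, ← hl']
    exact card_valueInversions_prod_le l'

theorem Mmax_two_eq {n : ℕ} (hn : 2 ≤ n) : Mmax 2 n = (3 * n - 5) / 2 := by
  apply IsGreatest.csSup_eq
  constructor
  · refine ⟨richWord n, isReducedWordFor_longestPerm_iff.2 ⟨prod_sgen_richWord n, ?_⟩,
      count_two_richWord hn⟩
    have h1 := two_mul_length_richWord n
    have h2 := two_mul_card_valueInversions_longestPerm n
    omega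
  · rintro _ ⟨l, hl, rfl⟩
    obtain ⟨h, hlen⟩ := isReducedWordFor_longestPerm_iff.1 hl
    have := two_mul_count_two_le hn l (by rw [h, hlen])
    omega

theorem stmt8 (n : ℕ) (hn : 3 ≤ n) : (Mmax 2 n : ℤ) = ⌈(3 * (n : ℚ)) / 2⌉ - 3 := by
  have hceil : ⌈(3 * (n : ℚ)) / 2⌉ = (((3 * n + 1) / 2 : ℕ) : ℤ) := by
    rw [Int.ceil_eq_iff]
    have h1 : 3 * n ≤ 2 * ((3 * n + 1) / 2) := by omega
    have h2 : 2 * ((3 * n + 1) / 2) ≤ 3 * n + 1 := by omega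
    have h1' : 3 * (n : ℚ) ≤ 2 * (((3 * n + 1) / 2 : ℕ) : ℚ) := by exact_mod_cast h1
    have h2' : 2 * (((3 * n + 1) / 2 : ℕ) : ℚ) ≤ 3 * (n : ℚ) + 1 := by exact_mod_cast h2
    rw [Int.cast_natCast]
    constructor <;> linarith
  rw [hceil, Mmax_two_eq (by omega)]
  omega
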